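/- For any natural number b and any finite multiset M of natural numbers, the polynomial C̃_{M,b}(q,t) = Σ_{P ∈ L_{M,b}} q^{area(P)} t^{depth(P)} is symmetric in q and t, i.e., C̃_{M,b}(q,t) = C̃_{M,b}(t,q). -/

import Mathlib

/-! ## Plane trees -/

/-- A plane tree: a root together with an ordered (left-to-right) list of subtrees.
A node is a *leaf* if it has no children, and *internal* otherwise. -/
inductive PTree : Type where
  | node : List PTree → PTree


namespace Luka

/-! ## Łukasiewicz paths

A path is encoded by its list of step increments: the step `(1,k)` (an up-step `U_k` of
degree `k`) is encoded by `k : ℤ` with `k ≥ 0`, and the down step `D = (1,-1)` by `-1`. -/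

/-- `P` is a Łukasiewicz path: it is nonempty, uses steps `(1,k)` with `k ≥ -1`,
stays (weakly) above the `x`-axis before its last step, and ends at height `-1`
(so that it goes strictly below the axis only at the last step, which is forced
to be the down-step `D`). -/
def IsLukas (P : List ℤ) : Prop :=
  P ≠ [] ∧ (∀ s ∈ P, -1 ≤ s) ∧ (∀ n, n < P.length → 0 ≤ (P.take n).sum) ∧ P.sum = -1

/-- The degrees of the up-steps of `P`, from left to right (the *profile* of `P`). -/
def upDegs (P : List ℤ) : List ℕ := (P.filter (fun s => 0 ≤ s)).map Int.toNat

/-- The profile multiset `𝔐(P)`: the multiset of degrees of the up-steps of `P`. -/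
def profileM (P : List ℤ) : Multiset ℕ := (upDegs P : Multiset ℕ)

/-- The degree of the first up-step of `P`, if any. -/
def firstUp? (P : List ℤ) : Option ℕ := (upDegs P).head?

/-- The degree of the last up-step of `P`, if any. -/
def lastUp? (P : List ℤ) : Option ℕ := (upDegs P).getLast?

/-- Auxiliary: starting from height `h`, record the starting height of every up-step. -/
def areaVecAux : ℤ → List ℤ → List ℤ
  | _, [] => []
  | h, s :: rest => (if 0 ≤ s then [h] else []) ++ areaVecAux (h + s) rest

/-- The area vector `Area(P)`: the `i`-th entry is the `y`-coordinate of the starting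
point of the `i`-th up-step of `P`. -/
def areaVec (P : List ℤ) : List ℤ := areaVecAux 0 P

/-- `area(P)`: the sum of the entries of the area vector (entries of a Łukasiewicz
path are nonnegative, so taking `Int.toNat` entrywise is harmless). -/
def area (P : List ℤ) : ℕ := ((areaVec P).map Int.toNat).sum

/-- Auxiliary computation of the depth values: `cur` is the depth value of the previous
step (`0` initially), and `stack` holds the pending depth values of the future matching
down-steps (top of the stack = value for the next matching down-step to come).
Reading an up-step `U_k` whose value is `cur` (inherited from the previous step) pushes
the values `cur+1, …, cur+k` for its `k` matching down-steps (its first matching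
down-step, which crosses its topmost interior level, gets `cur+1`, etc.); reading a
down-step pops its value.  The list returned records the value `d_i` of each up-step,
from left to right. -/
def depthVecAux : ℕ → List ℕ → List ℤ → List ℕ
  | _, _, [] => []
  | cur, stack, s :: rest =>
    if 0 ≤ s then
      cur :: depthVecAux cur ((List.range s.toNat).map (fun i => cur + i + 1) ++ stack) rest
    else
      match stack with
      | [] => depthVecAux cur [] rest
      | v :: st => depthVecAux v st rest

/-- The depth vector `Depth(P)`: the values `d_i` at the up-steps of `P`, left to right. -/
def depthVec (P : List ℤ) : List ℕ := depthVecAux 0 [] P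

/-- `depth(P)`: the sum of the entries of the depth vector. -/
def depth (P : List ℤ) : ℕ := (depthVec P).sum

/-- `P ∈ 𝓛_M`. -/
def MemL (M : Multiset ℕ) (P : List ℤ) : Prop := IsLukas P ∧ profileM P = M

/-- `P ∈ 𝓛_{a,M}`: first up-step of degree `a`, profile multiset `M ⊎ {a}`. -/
def MemLa (a : ℕ) (M : Multiset ℕ) (P : List ℤ) : Prop :=
  IsLukas P ∧ firstUp? P = some a ∧ profileM P = a ::ₘ M

/-- `P ∈ 𝓛_{M,b}`: last up-step of degree `b`, profile multiset `M ⊎ {b}`. -/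
def MemLb (M : Multiset ℕ) (b : ℕ) (P : List ℤ) : Prop :=
  IsLukas P ∧ lastUp? P = some b ∧ profileM P = b ::ₘ M

/-- `P ∈ 𝓛_{a,M,b}`: first up-step of degree `a`, last up-step of degree `b`,
profile multiset `M ⊎ {a, b}`. -/
def MemLab (a : ℕ) (M : Multiset ℕ) (b : ℕ) (P : List ℤ) : Prop :=
  IsLukas P ∧ firstUp? P = some a ∧ lastUp? P = some b ∧ profileM P = a ::ₘ b ::ₘ M

/-! ## Plane-tree statistics -/

/-- The (ordered) children of the root of a plane tree. -/
def children : PTree → List PTree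
  | .node ts => ts

/-- The degree of (the root of) a plane tree: its number of children. -/
def numChildren (t : PTree) : ℕ := (children t).length

mutual
/-- Number of internal nodes of a plane tree. -/
def internCount : PTree → ℕ
  | .node [] => 0
  | .node (t :: ts) => 1 + internCountL (t :: ts)
def internCountL : List PTree → ℕ
  | [] => 0
  | t :: ts => internCount t + internCountL ts
end

mutual
/-- `lthornT T` = the sum of `lthorn(u)` over all internal nodes `u` of `T`, where
`lthorn(u)` is the number of descending edges of strict ancestors `v` of `u` lying to
the left of the path from `v` to `u`.  (Every internal node of the subtree rooted at
the `i`-th child (0-indexed) of a node gains `i` left thorns from that node.) -/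
def lthornT : PTree → ℕ
  | .node ts => lthornL 0 ts
def lthornL : ℕ → List PTree → ℕ
  | _, [] => 0
  | i, t :: ts => lthornT t + i * internCount t + lthornL (i + 1) ts
end

mutual
/-- `rthornT T` = the sum of `rthorn(u)` over all internal nodes `u` of `T`, where
`rthorn(u)` is the number of descending edges of strict ancestors `v` of `u` lying to
the right of the path from `v` to `u`. -/
def rthornT : PTree → ℕ
  | .node ts => rthornL ts
def rthornL : List PTree → ℕ
  | [] => 0
  | t :: ts => rthornT t + ts.length * internCount t + rthornL ts
end

mutual
/-- The list of the values `lthorn(u)` for the internal nodes `u` of `T`, in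
contour-walk (preorder) order. -/
def lthornList : PTree → List ℕ
  | .node [] => []
  | .node (t :: ts) => 0 :: lthornLL 0 (t :: ts)
def lthornLL : ℕ → List PTree → List ℕ
  | _, [] => []
  | i, t :: ts => (lthornList t).map (· + i) ++ lthornLL (i + 1) ts
end

mutual
/-- The list of the values `rthorn(u)` for the internal nodes `u` of `T`, in
contour-walk (preorder) order. -/
def rthornList : PTree → List ℕ
  | .node [] => []
  | .node (t :: ts) => 0 :: rthornLL (t :: ts)
def rthornLL : List PTree → List ℕ
  | [] => []
  | t :: ts => (rthornList t).map (· + ts.length) ++ rthornLL ts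
end

/-! ## The bijections `λ` and `τ` -/

mutual
/-- `λ`: record each node of the tree at its first visit in the left-to-right contour
walk: `U_k` (i.e. `k`) for an internal node with `k+1` children, `D` (i.e. `-1`)
for a leaf. -/
def lambdaT : PTree → List ℤ
  | .node ts => ((ts.length : ℤ) - 1) :: lambdaL ts
def lambdaL : List PTree → List ℤ
  | [] => []
  | t :: ts => lambdaT t ++ lambdaL ts
end

/-- Auxiliary for `τ`: reading the path from right to left, maintain the stack of the
already-built subtrees (in left-to-right order); a down-step `D` creates a leaf and an
up-step `U_k` grabs the `k+1` topmost subtrees as its children.  This builds the same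
tree as the left-to-right "leftmost bud" construction. -/
def tauStack (P : List ℤ) : List PTree :=
  P.foldr (fun s st =>
    if s < 0 then PTree.node [] :: st
    else PTree.node (st.take (s.toNat + 1)) :: st.drop (s.toNat + 1)) []

/-- `τ`: the plane tree associated with a Łukasiewicz path. -/
def tau (P : List ℤ) : PTree := (tauStack P).headD (.node [])

mutual
/-- The mirror of a plane tree: reverse the left-to-right order of the children of
every internal node. -/
def mir : PTree → PTree
  | .node ts => .node (mirL ts).reverse
def mirL : List PTree → List PTree
  | [] => []
  | t :: ts => mir t :: mirL ts
end

mutual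
/-- The subtrees rooted at the internal nodes of `T`, in contour-walk (preorder)
order. -/
def internalSubtrees : PTree → List PTree
  | .node [] => []
  | .node (t :: ts) => .node (t :: ts) :: internalSubtreesL (t :: ts)
def internalSubtreesL : List PTree → List PTree
  | [] => []
  | t :: ts => internalSubtrees t ++ internalSubtreesL ts
end

/-- The multiset of degrees of the non-root internal nodes of `T`. -/
def nonRootInternalDegs (T : PTree) : Multiset ℕ :=
  (((internalSubtreesL (children T)).map numChildren : List ℕ) : Multiset ℕ)

/-! ## Lodestars and the lodestar swap -/

/-- A node is a lodestar-type node if it is internal and all its children are leaves. -/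
def isLodestarNode (t : PTree) : Bool :=
  !(children t).isEmpty && (children t).all (fun c => (children c).isEmpty)

mutual
/-- The subtree rooted at the *left lodestar* of `T`: the first internal node, in
contour-walk (preorder) order, all of whose children are leaves (if it exists). -/
def leftLode? : PTree → Option PTree
  | .node ts =>
    if isLodestarNode (.node ts) then some (.node ts) else leftLodeL? ts
def leftLodeL? : List PTree → Option PTree
  | [] => none
  | t :: ts =>
    match leftLode? t with
    | some r => some r
    | none => leftLodeL? ts
end

mutual
/-- The subtree rooted at the *right lodestar* of `T`: the last internal node, in
contour-walk (preorder) order, all of whose children are leaves (if it exists). -/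
def rightLode? : PTree → Option PTree
  | .node ts =>
    match rightLodeL? ts with
    | some r => some r
    | none => if isLodestarNode (.node ts) then some (.node ts) else none
def rightLodeL? : List PTree → Option PTree
  | [] => none
  | t :: ts =>
    match rightLodeL? ts with
    | some r => some r
    | none => rightLode? t
end

mutual
/-- Replace the left lodestar of `T` (first preorder all-leaf-children internal node)
by the tree `r`; `none` if `T` has no internal node. -/
def replF : PTree → PTree → Option PTree
  | r, .node ts =>
    if isLodestarNode (.node ts) then some r
    else (replFL r ts).map PTree.node
def replFL : PTree → List PTree → Option (List PTree)
  | _, [] => none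
  | r, t :: ts =>
    match replF r t with
    | some t' => some (t' :: ts)
    | none => (replFL r ts).map (t :: ·)
end

mutual
/-- Replace the right lodestar of `T` (last preorder all-leaf-children internal node)
by the tree `r`; `none` if `T` has no internal node. -/
def replL : PTree → PTree → Option PTree
  | r, .node ts =>
    match replLL r ts with
    | some ts' => some (.node ts')
    | none => if isLodestarNode (.node ts) then some r else none
def replLL : PTree → List PTree → Option (List PTree)
  | _, [] => none
  | r, t :: ts =>
    match replLL r ts with
    | some ts' => some (t :: ts')
    | none => (replL r t).map (· :: ts)
end

/-- The lodestar swap: exchange the subtrees rooted at the left lodestar and the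
right lodestar of `T` (each a node together with its pendant leaves). -/
def lodeSwap (T : PTree) : PTree :=
  match leftLode? T, rightLode? T with
  | some L, some R => ((replF R T).bind (replL L)).getD T
  | _, _ => T

end Luka

namespace Luka

/-- A plane forest in first-child / next-sibling form: `cons c r` is the forest whose first tree
has the trees of `c` as the subtrees of its root, followed by the trees of `r`. -/
inductive Forest : Type where
  | nil : Forest
  | cons : Forest → Forest → Forest

namespace Forest

/-- The number of trees of a forest. -/
def len : Forest → ℕ
  | nil => 0
  | cons _ r => len r + 1

/-- Concatenation of forests. -/
def append : Forest → Forest → Forest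
  | nil, g => g
  | cons c r, g => cons c (append r g)

/-- The forest of `k` leaves. -/
def leaves : ℕ → Forest
  | 0 => nil
  | k + 1 => cons nil (leaves k)

/-- The number of internal nodes. -/
def inner : Forest → ℕ
  | nil => 0
  | cons c r => (if len c = 0 then 0 else 1) + inner c + inner r

/-- The total number of left thorns of the internal nodes; the `i`-th tree of the forest has
`i` thorns to its left. -/
def lthorns : Forest → ℕ
  | nil => 0
  | cons c r => lthorns c + lthorns r + inner r

/-- The total number of right thorns of the internal nodes. -/
def rthorns : Forest → ℕ
  | nil => 0
  | cons c r => rthorns c + len r * ((if len c = 0 then 0 else 1) + inner c) + rthorns r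

/-- The mirror image of a forest. -/
def mirror : Forest → Forest
  | nil => nil
  | cons c r => append (mirror r) (cons (mirror c) nil)

/-- The list of the values `k` for the internal nodes with `k + 1` children, in preorder. -/
def degs : Forest → List ℕ
  | nil => []
  | cons c r => (if len c = 0 then [] else [len c - 1]) ++ degs c ++ degs r

/-- The list of the values `k` for the internal nodes with `k + 1` children, all of which
are leaves (the lodestars), in preorder. -/
def lodes : Forest → List ℕ
  | nil => []
  | cons c r => (if len c ≠ 0 ∧ lodes c = [] then [len c - 1] else lodes c) ++ lodes r

/-- Replace the degrees of the lodestars by the entries of a list. -/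
def fill : Forest → List ℕ → Forest
  | nil, _ => nil
  | cons c r, l =>
    if len c ≠ 0 ∧ lodes c = [] then cons (leaves (l.headD 0 + 1)) (fill r l.tail)
    else cons (fill c (l.take (lodes c).length)) (fill r (l.drop (lodes c).length))

/-- The path of a forest: the preorder list of `(number of children) - 1`. -/
def code : Forest → List ℤ
  | nil => []
  | cons c r => ((len c : ℤ) - 1) :: (code c ++ code r)

/-- The first `k` trees of a forest. -/
def take : ℕ → Forest → Forest
  | 0, _ => nil
  | _ + 1, nil => nil
  | k + 1, cons c r => cons c (take k r)

/-- All but the first `k` trees of a forest. -/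
def drop : ℕ → Forest → Forest
  | 0, f => f
  | _ + 1, nil => nil
  | k + 1, cons _ r => drop k r

/-- The forest of a path. -/
def decode : List ℤ → Forest
  | [] => nil
  | s :: P => cons (take (s + 1).toNat (decode P)) (drop (s + 1).toNat (decode P))

/-- The mirror image with the lodestar degrees kept in their original order. -/
def flip (f : Forest) : Forest := fill (mirror f) (lodes f)

/-! ### Lodestars -/

@[simp] theorem len_leaves (k : ℕ) : len (leaves k) = k := by
  induction k <;> simp_all [leaves, len]

@[simp] theorem lodes_leaves (k : ℕ) : lodes (leaves k) = [] := by
  induction k <;> simp_all [leaves, lodes, len]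

@[simp] theorem inner_leaves (k : ℕ) : inner (leaves k) = 0 := by
  induction k <;> simp_all [leaves, inner, len]

@[simp] theorem degs_leaves (k : ℕ) : degs (leaves k) = [] := by
  induction k <;> simp_all [leaves, degs, len]

@[simp] theorem lthorns_leaves (k : ℕ) : lthorns (leaves k) = 0 := by
  induction k <;> simp_all [leaves, lthorns]

@[simp] theorem rthorns_leaves (k : ℕ) : rthorns (leaves k) = 0 := by
  induction k <;> simp_all [leaves, rthorns, inner, len]

theorem eq_nil_of_len_eq_zero {f : Forest} (h : len f = 0) : f = nil := by
  cases f <;> simp_all [len]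

theorem eq_leaves_of_lodes_eq_nil {f : Forest} (h : lodes f = []) : f = leaves (len f) := by
  induction f with
  | nil => rfl
  | cons c r ihc ihr =>
    simp only [lodes, List.append_eq_nil_iff] at h
    split_ifs at h with hc
    · simp at h
    · have hc0 : len c = 0 := by by_contra h0; exact hc ⟨h0, h.1⟩
      rw [eq_nil_of_len_eq_zero hc0]
      simpa [len, leaves] using ihr h.2

/-- Induction on forests, by whether the first tree is a leaf, a lodestar, or neither. -/
theorem lode_induction {p : Forest → Prop} (nil : p nil) (leaf : ∀ r, p r → p (cons .nil r))
    (lode : ∀ k r, p r → p (cons (leaves (k + 1)) r))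
    (node : ∀ c r, lodes c ≠ [] → p c → p r → p (cons c r)) (f : Forest) : p f := by
  induction f with
  | nil => exact nil
  | cons c r ihc ihr =>
    by_cases h : lodes c = []
    · rw [eq_leaves_of_lodes_eq_nil h]
      cases len c with
      | zero => exact leaf r ihr
      | succ k => exact lode k r ihr
    · exact node c r h ihc ihr

@[simp] theorem lodes_cons_nil (r : Forest) : lodes (cons nil r) = lodes r := by
  simp [lodes, len]

@[simp] theorem lodes_cons_leaves (k : ℕ) (r : Forest) :
    lodes (cons (leaves (k + 1)) r) = k :: lodes r := by
  simp [lodes]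

theorem lodes_cons_of_ne {c : Forest} (h : lodes c ≠ []) (r : Forest) :
    lodes (cons c r) = lodes c ++ lodes r := by
  simp [lodes, h]

@[simp] theorem fill_cons_nil (r : Forest) (l : List ℕ) :
    fill (cons nil r) l = cons nil (fill r l) := by
  simp [fill, len, lodes]

@[simp] theorem fill_cons_leaves (k x : ℕ) (r : Forest) (l : List ℕ) :
    fill (cons (leaves (k + 1)) r) (x :: l) = cons (leaves (x + 1)) (fill r l) := by
  simp [fill]

theorem fill_cons_of_ne {c : Forest} (h : lodes c ≠ []) (r : Forest) {l₁ : List ℕ}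
    (hl : l₁.length = (lodes c).length) (l₂ : List ℕ) :
    fill (cons c r) (l₁ ++ l₂) = cons (fill c l₁) (fill r l₂) := by
  simp [fill, h, ← hl]

/-- Induction on a forest together with a list of new degrees for its lodestars. -/
theorem fill_induction {p : (f : Forest) → (l : List ℕ) → l.length = (lodes f).length → Prop}
    (nil : p nil [] rfl)
    (leaf : ∀ r l (hl : l.length = (lodes r).length), p r l hl →
      p (cons .nil r) l (by rw [hl, lodes_cons_nil]))
    (lode : ∀ k r x l (hl : l.length = (lodes r).length), p r l hl →
      p (cons (leaves (k + 1)) r) (x :: l) (by simp [hl]))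
    (node : ∀ c r l₁ l₂ (h : lodes c ≠ []) (h₁ : l₁.length = (lodes c).length)
      (h₂ : l₂.length = (lodes r).length), p c l₁ h₁ → p r l₂ h₂ →
      p (cons c r) (l₁ ++ l₂) (by simp [lodes_cons_of_ne h, h₁, h₂]))
    (f : Forest) (l : List ℕ) (hl : l.length = (lodes f).length) : p f l hl := by
  induction f using lode_induction generalizing l with
  | nil =>
    obtain rfl : l = [] := by simpa [lodes] using hl
    exact nil
  | leaf r ih => exact leaf r l _ (ih l (by rw [hl, lodes_cons_nil]))
  | lode k r ih =>
    cases l with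
    | nil => simp at hl
    | cons x l => exact lode k r x l _ (ih l (by simpa using hl))
  | node c r h ihc ihr =>
    obtain ⟨l₁, l₂, rfl, h₁, h₂⟩ : ∃ l₁ l₂, l = l₁ ++ l₂ ∧ l₁.length = (lodes c).length ∧
        l₂.length = (lodes r).length := by
      rw [lodes_cons_of_ne h, List.length_append] at hl
      refine ⟨_, _, (List.take_append_drop (lodes c).length l).symm, ?_, ?_⟩
      · rw [List.length_take]; omega
      · rw [List.length_drop]; omega
    exact node c r l₁ l₂ h h₁ h₂ (ihc _ h₁) (ihr _ h₂)

@[simp] theorem fill_nil (l : List ℕ) : fill nil l = nil := rfl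

theorem lodes_fill (f : Forest) (l : List ℕ) (hl : l.length = (lodes f).length) :
    lodes (fill f l) = l := by
  induction f, l, hl using fill_induction with
  | nil => rfl
  | leaf r l hl ih => simp [ih]
  | lode k r x l hl ih => simp [ih]
  | node c r l₁ l₂ h h₁ h₂ ih₁ ih₂ =>
    have : lodes (fill c l₁) ≠ [] := by
      rw [ih₁]
      exact List.ne_nil_of_length_pos (h₁ ▸ List.length_pos_of_ne_nil h)
    rw [fill_cons_of_ne h r h₁, lodes_cons_of_ne this, ih₁, ih₂]

theorem lodes_fill_ne_nil {f : Forest} (h : lodes f ≠ []) {l : List ℕ}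
    (hl : l.length = (lodes f).length) : lodes (fill f l) ≠ [] := by
  rw [lodes_fill f l hl]
  exact List.ne_nil_of_length_pos (hl ▸ List.length_pos_of_ne_nil h)

theorem fill_lodes (f : Forest) : fill f (lodes f) = f := by
  induction f using lode_induction with
  | nil => rfl
  | leaf r ih => simp [ih]
  | lode k r ih => simp [ih]
  | node c r h ihc ihr => rw [lodes_cons_of_ne h, fill_cons_of_ne h r rfl, ihc, ihr]

theorem fill_fill (f : Forest) (l l' : List ℕ) (hl : l.length = (lodes f).length)
    (hl' : l'.length = (lodes f).length) : fill (fill f l) l' = fill f l' := by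
  induction f, l, hl using fill_induction generalizing l' with
  | nil => rfl
  | leaf r l hl ih => simp_all
  | lode k r x l hl ih =>
    cases l' with
    | nil => simp at hl'
    | cons y l' => simp_all
  | node c r l₁ l₂ h h₁ h₂ ih₁ ih₂ =>
    rw [lodes_cons_of_ne h, List.length_append] at hl'
    have h₁' : (l'.take (lodes c).length).length = (lodes c).length := by
      rw [List.length_take]; omega
    have h₂' : (l'.drop (lodes c).length).length = (lodes r).length := by
      rw [List.length_drop]; omega
    rw [← List.take_append_drop (lodes c).length l', fill_cons_of_ne h r h₁,
      fill_cons_of_ne (lodes_fill_ne_nil h h₁) _ (by rw [h₁', lodes_fill c l₁ h₁, h₁]),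
      fill_cons_of_ne h r h₁', ih₁ _ h₁', ih₂ _ h₂']

theorem len_fill (f : Forest) (l : List ℕ) (hl : l.length = (lodes f).length) :
    len (fill f l) = len f := by
  induction f, l, hl using fill_induction with
  | node c r l₁ l₂ h h₁ h₂ ih₁ ih₂ => simp [fill_cons_of_ne h r h₁, len, ih₂]
  | _ => simp_all [len]

theorem inner_fill (f : Forest) (l : List ℕ) (hl : l.length = (lodes f).length) :
    inner (fill f l) = inner f := by
  induction f, l, hl using fill_induction with
  | nil => rfl
  | node c r l₁ l₂ h h₁ h₂ ih₁ ih₂ =>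
    simp [fill_cons_of_ne h r h₁, inner, ih₁, ih₂, len_fill c l₁ h₁]
  | _ => simp_all [inner]

theorem lthorns_fill (f : Forest) (l : List ℕ) (hl : l.length = (lodes f).length) :
    lthorns (fill f l) = lthorns f := by
  induction f, l, hl using fill_induction with
  | nil => rfl
  | node c r l₁ l₂ h h₁ h₂ ih₁ ih₂ =>
    simp [fill_cons_of_ne h r h₁, lthorns, ih₁, ih₂, inner_fill r l₂ h₂]
  | _ => simp_all [lthorns, inner_fill]

theorem rthorns_fill (f : Forest) (l : List ℕ) (hl : l.length = (lodes f).length) :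
    rthorns (fill f l) = rthorns f := by
  induction f, l, hl using fill_induction with
  | nil => rfl
  | node c r l₁ l₂ h h₁ h₂ ih₁ ih₂ =>
    simp [fill_cons_of_ne h r h₁, rthorns, ih₁, ih₂, inner_fill c l₁ h₁, len_fill c l₁ h₁,
      len_fill r l₂ h₂]
  | _ => simp_all [rthorns, len_fill]

theorem degs_fill_perm (f : Forest) (l : List ℕ) (hl : l.length = (lodes f).length) :
    (degs (fill f l) + lodes f : Multiset ℕ) = degs f + l := by
  induction f, l, hl using fill_induction with
  | nil => rfl
  | leaf r l hl ih => simpa [degs, len] using ih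
  | lode k r x l hl ih =>
    simp only [fill_cons_leaves, degs, len_leaves, degs_leaves, lodes_cons_leaves,
      ← Multiset.cons_coe, ← Multiset.coe_add, ← Multiset.singleton_add] at ih ⊢
    simp only [Nat.add_eq_zero_iff, one_ne_zero, and_false, if_false, Nat.add_sub_cancel,
      Multiset.coe_nil, Multiset.coe_singleton, add_zero]
    rw [show ({x} + ↑(degs (fill r l)) + ({k} + ↑(lodes r)) : Multiset ℕ)
      = {x} + {k} + (↑(degs (fill r l)) + ↑(lodes r)) by abel, ih]
    abel
  | node c r l₁ l₂ h h₁ h₂ ih₁ ih₂ =>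
    rw [fill_cons_of_ne h r h₁, lodes_cons_of_ne h]
    simp only [degs, len_fill c l₁ h₁, ← Multiset.coe_add]
    generalize ((if len c = 0 then [] else [len c - 1] : List ℕ) : Multiset ℕ) = z
    rw [show z + ↑(degs (fill c l₁)) + ↑(degs (fill r l₂)) + (↑(lodes c) + ↑(lodes r))
      = z + (↑(degs (fill c l₁)) + ↑(lodes c)) + (↑(degs (fill r l₂)) + ↑(lodes r)) by abel,
      ih₁, ih₂]
    abel

theorem getLast?_degs (f : Forest) : (degs f).getLast? = (lodes f).getLast? := by
  induction f using lode_induction with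
  | nil => rfl
  | leaf r ih => simpa [degs, len] using ih
  | lode k r ih => simp [degs, List.getLast?_cons, ih]
  | node c r h ihc ihr =>
    rw [lodes_cons_of_ne h, degs, List.getLast?_append, List.getLast?_append,
      List.getLast?_append, ihc, ihr, List.getLast?_eq_some_getLast h]
    simp

/-! ### Mirror images -/

theorem append_nil (f : Forest) : append f nil = f := by
  induction f <;> simp_all [append]

theorem append_assoc (f g h : Forest) : append (append f g) h = append f (append g h) := by
  induction f <;> simp_all [append]

theorem len_append (f g : Forest) : len (append f g) = len f + len g := by
  induction f <;> simp_all [append, len]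
  omega

theorem inner_append (f g : Forest) : inner (append f g) = inner f + inner g := by
  induction f <;> simp_all [append, inner]
  omega

theorem lthorns_append (f g : Forest) :
    lthorns (append f g) = lthorns f + lthorns g + len f * inner g := by
  induction f with
  | nil => simp [append, lthorns, len]
  | cons c r _ ih => simp only [append, lthorns, len, ih, inner_append]; ring

theorem lodes_append (f g : Forest) : lodes (append f g) = lodes f ++ lodes g := by
  induction f <;> simp_all [append, lodes]

theorem degs_append (f g : Forest) : degs (append f g) = degs f ++ degs g := by
  induction f <;> simp_all [append, degs]

theorem fill_append (f g : Forest) (l₁ l₂ : List ℕ) (h₁ : l₁.length = (lodes f).length) :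
    fill (append f g) (l₁ ++ l₂) = append (fill f l₁) (fill g l₂) := by
  induction f, l₁, h₁ using fill_induction with
  | nil => rfl
  | node c r l l' h h₁ h₂ ih₁ ih₂ =>
    rw [fill_cons_of_ne h r h₁, append, append, List.append_assoc, fill_cons_of_ne h _ h₁, ih₂]
  | _ => simp_all [append]

theorem len_mirror (f : Forest) : len (mirror f) = len f := by
  induction f <;> simp_all [mirror, len, len_append]

theorem inner_mirror (f : Forest) : inner (mirror f) = inner f := by
  induction f <;> simp_all [mirror, inner, inner_append, len_mirror]
  omega

theorem lthorns_mirror (f : Forest) : lthorns (mirror f) = rthorns f := by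
  induction f with
  | nil => rfl
  | cons c r ihc ihr =>
    simp only [mirror, lthorns, rthorns, lthorns_append, inner, len_mirror, inner_mirror, ihc, ihr]
    ring

theorem mirror_append (f g : Forest) :
    mirror (append f g) = append (mirror g) (mirror f) := by
  induction f <;> simp_all [append, mirror, append_nil, append_assoc]

theorem mirror_mirror (f : Forest) : mirror (mirror f) = f := by
  induction f <;> simp_all [mirror, mirror_append, append]

theorem rthorns_mirror (f : Forest) : rthorns (mirror f) = lthorns f := by
  rw [← lthorns_mirror, mirror_mirror]

theorem mirror_leaves (k : ℕ) : mirror (leaves k) = leaves k := by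
  induction k with
  | zero => rfl
  | succ k ih =>
    have h (k : ℕ) : append (leaves k) (cons nil nil) = leaves (k + 1) := by
      induction k <;> simp_all [append, leaves]
    simp [leaves, mirror, ih, h]

theorem lodes_mirror (f : Forest) : lodes (mirror f) = (lodes f).reverse := by
  induction f with
  | nil => rfl
  | cons c r ihc ihr =>
    simp only [mirror, lodes, lodes_append, ihc, ihr, len_mirror, List.reverse_append,
      List.reverse_eq_nil_iff, List.append_nil]
    split_ifs <;> simp

theorem degs_mirror_perm (f : Forest) : (degs (mirror f) : Multiset ℕ) = degs f := by
  induction f with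
  | nil => rfl
  | cons c r ihc ihr =>
    simp only [mirror, degs, degs_append, ← Multiset.coe_add, ihc, ihr, len_mirror]
    simp only [Multiset.coe_nil, add_zero]
    abel

theorem mirror_fill (f : Forest) (l : List ℕ) (hl : l.length = (lodes f).length) :
    mirror (fill f l) = fill (mirror f) l.reverse := by
  induction f, l, hl using fill_induction with
  | nil => rfl
  | leaf r l hl ih =>
    have := fill_append (mirror r) (cons nil nil) l.reverse [] (by simp [lodes_mirror, hl])
    simp_all [mirror]
  | lode k r x l hl ih =>
    have := fill_append (mirror r) (cons (leaves (k + 1)) nil) l.reverse [x]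
      (by simp [lodes_mirror, hl])
    simp_all [mirror, mirror_leaves]
  | node c r l₁ l₂ h h₁ h₂ ih₁ ih₂ =>
    have hc : lodes (mirror c) ≠ [] := by simpa [lodes_mirror] using h
    have h₁' : l₁.reverse.length = (lodes (mirror c)).length := by simp [lodes_mirror, h₁]
    have hcons := fill_cons_of_ne hc nil h₁' []
    rw [List.append_nil] at hcons
    rw [fill_cons_of_ne h r h₁, mirror, mirror, List.reverse_append,
      fill_append _ _ _ _ (by simp [lodes_mirror, h₂]), hcons, ih₁, ih₂, fill]

/-! ### The involution -/

theorem length_lodes_mirror (f : Forest) :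
    (lodes f).length = (lodes (mirror f)).length := by
  simp [lodes_mirror]

theorem lodes_flip (f : Forest) : lodes (flip f) = lodes f :=
  lodes_fill _ _ (length_lodes_mirror f)

theorem flip_flip (f : Forest) : flip (flip f) = f := by
  have h := length_lodes_mirror f
  rw [flip, lodes_flip, flip, mirror_fill _ _ h, mirror_mirror,
    fill_fill _ _ _ (by simp) rfl, fill_lodes]

theorem len_flip (f : Forest) : len (flip f) = len f := by
  rw [flip, len_fill _ _ (length_lodes_mirror f), len_mirror]

theorem lthorns_flip (f : Forest) : lthorns (flip f) = rthorns f := by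
  rw [flip, lthorns_fill _ _ (length_lodes_mirror f), lthorns_mirror]

theorem rthorns_flip (f : Forest) : rthorns (flip f) = lthorns f := by
  rw [flip, rthorns_fill _ _ (length_lodes_mirror f), rthorns_mirror]

theorem degs_flip_perm (f : Forest) : (degs (flip f) : Multiset ℕ) = degs f := by
  have h := degs_fill_perm _ _ (length_lodes_mirror f)
  rw [lodes_mirror, degs_mirror_perm, Multiset.coe_reverse] at h
  exact add_right_cancel h

theorem getLast?_degs_flip (f : Forest) : (degs (flip f)).getLast? = (degs f).getLast? := by
  rw [getLast?_degs, getLast?_degs, lodes_flip]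

/-! ### Paths -/

theorem take_append (f g : Forest) : take (len f) (append f g) = f := by
  induction f <;> simp_all [append, len, take]

theorem drop_append (f g : Forest) : drop (len f) (append f g) = g := by
  induction f <;> simp_all [append, len, drop]

theorem decode_code_append (f : Forest) (P : List ℤ) :
    decode (code f ++ P) = append f (decode P) := by
  induction f generalizing P with
  | nil => rfl
  | cons c r ihc ihr => simp [code, decode, ihc, ihr, take_append, drop_append, append]

theorem decode_code (f : Forest) : decode (code f) = f := by
  simpa [decode, append_nil] using decode_code_append f []

theorem append_take_drop (k : ℕ) (f : Forest) : append (take k f) (drop k f) = f := by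
  induction k generalizing f with
  | zero => simp [take, drop, append]
  | succ k ih => cases f <;> simp [take, drop, append, ih]

theorem len_take {k : ℕ} {f : Forest} (h : k ≤ len f) : len (take k f) = k := by
  induction k generalizing f with
  | zero => simp [take, len]
  | succ k ih => cases f <;> simp_all [take, len]

theorem code_append (f g : Forest) : code (append f g) = code f ++ code g := by
  induction f <;> simp_all [append, code]

theorem sum_code (f : Forest) : (code f).sum = -(len f : ℤ) := by
  induction f with
  | nil => rfl
  | cons c r ihc ihr => simp only [code, len, List.sum_cons, List.sum_append, ihc, ihr]; grind

theorem neg_one_le_of_mem_code (f : Forest) : ∀ s ∈ code f, -1 ≤ s := by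
  induction f with
  | nil => simp [code]
  | cons c r ihc ihr =>
    simp only [code, List.mem_cons, List.mem_append]
    rintro s (rfl | h | h)
    · omega
    · exact ihc s h
    · exact ihr s h

theorem sum_drop_code_neg (f : Forest) (n : ℕ) (hn : n < (code f).length) :
    ((code f).drop n).sum < 0 := by
  induction f generalizing n with
  | nil => simp [code] at hn
  | cons c r ihc ihr =>
    cases n with
    | zero => rw [List.drop_zero, sum_code, len]; omega
    | succ n =>
      rw [code, List.drop_succ_cons, List.drop_append, List.sum_append]
      simp only [code, List.length_cons, List.length_append] at hn
      rcases lt_or_ge n (code c).length with h | h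
      · rw [Nat.sub_eq_zero_of_le h.le, List.drop_zero, sum_code]
        have := ihc n h
        omega
      · rw [List.drop_eq_nil_of_le h, List.sum_nil, zero_add]
        exact ihr _ (by omega)

theorem isLukas_code {f : Forest} (h : len f = 1) : IsLukas (code f) := by
  refine ⟨?_, neg_one_le_of_mem_code f, fun n hn => ?_, by simp [sum_code, h]⟩
  · cases f <;> simp_all [code, len]
  · have := sum_drop_code_neg f n hn
    have h' := List.sum_take_add_sum_drop (code f) n
    rw [sum_code, h] at h'
    omega

theorem code_decode_of_sum_drop_neg (P : List ℤ) (hs : ∀ s ∈ P, -1 ≤ s)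
    (h : ∀ n < P.length, (P.drop n).sum < 0) : code (decode P) = P := by
  induction P with
  | nil => rfl
  | cons s P ih =>
    have hP := ih (fun x hx => hs x (List.mem_cons_of_mem _ hx)) fun n hn => by
      simpa using h (n + 1) (by simpa using hn)
    have h0 := h 0 (by simp)
    have hs0 := hs s (by simp)
    have hsum := sum_code (decode P)
    rw [hP] at hsum
    rw [List.drop_zero, List.sum_cons] at h0
    rw [decode, code, len_take (by omega), ← code_append, append_take_drop, hP]
    congr 1
    omega

theorem code_decode {P : List ℤ} (h : IsLukas P) : code (decode P) = P := by
  refine code_decode_of_sum_drop_neg P h.2.1 fun n hn => ?_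
  have h₁ := h.2.2.1 n hn
  have h₂ := List.sum_take_add_sum_drop P n
  rw [h.2.2.2] at h₂
  omega

theorem len_decode {P : List ℤ} (h : IsLukas P) : len (decode P) = 1 := by
  have h' := sum_code (decode P)
  rw [code_decode h, h.2.2.2] at h'
  omega

theorem upDegs_code (f : Forest) : upDegs (code f) = degs f := by
  induction f with
  | nil => rfl
  | cons c r ihc ihr =>
    simp only [upDegs] at ihc ihr
    simp only [upDegs, code, degs, List.filter_cons, List.filter_append, decide_eq_true_eq]
    by_cases h : len c = 0
    · simp [h, ihc, ihr]
    · rw [if_pos (by omega), if_neg h, List.map_cons, List.map_append, ihc, ihr]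
      simp

theorem areaVecAux_append (h : ℤ) (P Q : List ℤ) :
    areaVecAux h (P ++ Q) = areaVecAux h P ++ areaVecAux (h + P.sum) Q := by
  induction P generalizing h with
  | nil => simp [areaVecAux]
  | cons s P ih => simp [areaVecAux, ih, add_assoc]

theorem sum_areaVecAux_code (f : Forest) (m : ℕ) :
    ((areaVecAux (m + len f - 1) (code f)).map Int.toNat).sum = rthorns f + inner f * m := by
  induction f generalizing m with
  | nil => simp [areaVecAux, code, rthorns, inner]
  | cons c r ihc ihr =>
    have hc := ihc (m + len r)
    have hr := ihr m
    rw [code, areaVecAux, areaVecAux_append, sum_code, len]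
    rw [show (m + (len r + 1 : ℕ) - 1 + ((len c : ℤ) - 1) : ℤ)
      = (m + len r : ℕ) + len c - 1 by push_cast; ring]
    rw [show (((m + len r : ℕ) : ℤ) + len c - 1 + -(len c : ℤ)) = m + len r - 1 by
      push_cast; ring]
    rw [List.map_append, List.map_append, List.sum_append, List.sum_append, hc, hr,
      rthorns, inner]
    by_cases h : len c = 0
    · simp [h]; ring
    · rw [if_pos (by omega), if_neg h]
      rw [show (m + (len r + 1 : ℕ) - 1 : ℤ) = (m + len r : ℕ) by push_cast; ring]
      simp only [List.map_cons, List.map_nil, List.sum_cons, List.sum_nil, Int.toNat_natCast]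
      ring

theorem area_code {f : Forest} (h : len f = 1) : area (code f) = rthorns f := by
  simpa [area, areaVec, h] using sum_areaVecAux_code f 0

theorem depthVecAux_natCast_cons (cur : ℕ) (stack : List ℕ) (k : ℕ) (P : List ℤ) :
    depthVecAux cur stack ((k : ℤ) :: P) =
      cur :: depthVecAux cur ((List.range k).map (fun i => cur + i + 1) ++ stack) P := by
  rw [depthVecAux.eq_def]
  simp

/-- In the computation of the depth vector, the current value followed by the stack form a list
starting with the depths of the roots of the trees about to be read. -/
theorem sum_depthVecAux_code (f : Forest) (d cur : ℕ) (stack T : List ℕ) (P : List ℤ)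
    (hst : cur :: stack = List.range' d (len f) ++ T) (hT : P ≠ [] → T ≠ []) :
    (depthVecAux cur stack (code f ++ P)).sum =
      lthorns f + d * inner f + (depthVecAux (T.headD 0) T.tail P).sum := by
  induction f generalizing d cur stack T P with
  | nil =>
    obtain rfl : cur :: stack = T := by simpa [len] using hst
    simp [code, lthorns, inner]
  | cons c r ihc ihr =>
    rw [len, List.range'_succ, List.cons_append, List.cons.injEq] at hst
    obtain ⟨rfl, rfl⟩ := hst
    have hrest : code r ++ P ≠ [] → List.range' (cur + 1) (len r) ++ T ≠ [] := by
      cases r <;> simp_all [len, code, List.range'_succ]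
    have hr : (depthVecAux ((List.range' (cur + 1) (len r) ++ T).headD 0)
        (List.range' (cur + 1) (len r) ++ T).tail (code r ++ P)).sum =
        lthorns r + (cur + 1) * inner r + (depthVecAux (T.headD 0) T.tail P).sum := by
      rcases eq_or_ne (List.range' (cur + 1) (len r) ++ T) [] with h | h
      · have h' := not_imp_not.2 hrest (not_not.2 h)
        simp only [ne_eq, not_not, List.append_eq_nil_iff] at h h'
        cases r with
        | nil => simp [h, h', code, depthVecAux, lthorns, inner]
        | cons _ _ => simp [code] at h'
      · refine ihr (cur + 1) _ _ T P ?_ hT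
        rw [List.headD_eq_head?_getD, List.head?_eq_some_head h]
        exact List.cons_head_tail h
    rw [code, List.cons_append, List.append_assoc, lthorns, inner]
    generalize List.range' (cur + 1) (len r) ++ T = U at hr hrest ⊢
    by_cases h : len c = 0
    · obtain rfl := eq_nil_of_len_eq_zero h
      cases U with
      | nil =>
        obtain ⟨h₁, rfl⟩ : code r = [] ∧ P = [] := by simpa using hrest
        rw [h₁] at hr ⊢
        simp only [List.append_nil, depthVecAux, code, len, inner, lthorns] at hr ⊢
        simp only [if_true, CharP.cast_eq_zero, zero_sub, Int.reduceNeg, Int.reduceLE, if_false,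
          List.sum_nil, zero_add, add_zero] at hr ⊢
        rw [hr]
        ring
      | cons v U =>
        simp only [List.headD_cons, List.tail_cons] at hr
        simp [depthVecAux, len, code, inner, lthorns, hr]
        ring
    · obtain ⟨k, hk⟩ := Nat.exists_eq_succ_of_ne_zero h
      have hc := ihc cur cur ((List.range k).map (fun i => cur + i + 1) ++ U) U (code r ++ P)
        (by
          rw [hk, List.range'_succ, List.cons_append, List.range'_eq_map_range]
          simp only [add_right_comm]) hrest
      have hs : ((len c : ℤ) - 1) = k := by rw [hk]; push_cast; ring
      rw [hs, depthVecAux_natCast_cons, List.sum_cons, hc, hr, if_neg h]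
      ring

theorem depth_code {f : Forest} (h : len f = 1) : depth (code f) = lthorns f := by
  have := sum_depthVecAux_code f 0 0 [] [] [] (by simp [h]) (by simp)
  simpa [depth, depthVec, depthVecAux] using this

/-- The involution on paths induced by `flip` preserves each set `𝓛_{M,b}`. -/
theorem memLb_code_flip {M : Multiset ℕ} {b : ℕ} {P : List ℤ} (h : MemLb M b P) :
    MemLb M b (code (flip (decode P))) := by
  obtain ⟨hP, hb, hM⟩ := h
  rw [← code_decode hP, lastUp?, upDegs_code] at hb
  rw [← code_decode hP, profileM, upDegs_code] at hM
  refine ⟨isLukas_code ((len_flip _).trans (len_decode hP)), ?_, ?_⟩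
  · rw [lastUp?, upDegs_code, getLast?_degs_flip, hb]
  · rw [profileM, upDegs_code, degs_flip_perm, hM]

theorem area_code_flip {P : List ℤ} (h : IsLukas P) :
    area (code (flip (decode P))) = depth P := by
  have hl := len_decode h
  rw [area_code ((len_flip _).trans hl), rthorns_flip, ← depth_code hl, code_decode h]

theorem depth_code_flip {P : List ℤ} (h : IsLukas P) :
    depth (code (flip (decode P))) = area P := by
  have hl := len_decode h
  rw [depth_code ((len_flip _).trans hl), lthorns_flip, ← area_code hl, code_decode h]

theorem code_flip_code_flip {P : List ℤ} (h : IsLukas P) :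
    code (flip (decode (code (flip (decode P))))) = P := by
  rw [decode_code, flip_flip, code_decode h]

end Forest

end Luka

open Luka in
/-- **[QZ25, Conjecture 1.4] (corollary form).**  For any natural `b` and any finite
multiset `M` of naturals, the polynomial
`C̃_{M,b}(q,t) = Σ_{P ∈ 𝓛_{M,b}} q^{area(P)} t^{depth(P)}` is symmetric in `q, t`.
The finite set `𝓛_{M,b}` is presented as an arbitrary `Finset S` whose members are
exactly the Łukasiewicz paths with last up-step of degree `b` and profile multiset
`M ⊎ {b}`. -/
theorem tildeC_Mb_qt_symm (b : ℕ) (M : Multiset ℕ) {R : Type*} [CommSemiring R]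
    (q t : R) (S : Finset (List ℤ)) (hS : ∀ P, P ∈ S ↔ MemLb M b P) :
    ∑ P ∈ S, q ^ area P * t ^ depth P = ∑ P ∈ S, t ^ area P * q ^ depth P := by
  have hL (P) (hP : P ∈ S) : IsLukas P := ((hS P).1 hP).1
  have hmem (P) (hP : P ∈ S) : Forest.code (Forest.decode P).flip ∈ S :=
    (hS _).2 (Forest.memLb_code_flip ((hS P).1 hP))
  refine Finset.sum_nbij' (fun P => Forest.code (Forest.decode P).flip)
    (fun P => Forest.code (Forest.decode P).flip) hmem hmem
    (fun P hP => Forest.code_flip_code_flip (hL P hP))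
    (fun P hP => Forest.code_flip_code_flip (hL P hP)) fun P hP => ?_
  rw [Forest.area_code_flip (hL P hP), Forest.depth_code_flip (hL P hP), mul_comm]
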